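/- Every nonzero element x of F_{2ℝ} of a given rank is Aut-related to a canonical form as follows: if x ≠ 0 and Υ(x, y) = 0 for all y (rank 1), then x is Aut-related to (1, 0, 0, 0); if T(x) = 0 and there exists y with Υ(x, y) ≠ 0 (rank 2), then x is Aut-related to (1, 0, (1; 0), 0) or (1, 0, (−1; 0), 0); if Δ(x) = 0 and T(x) ≠ 0 (rank 3), then x is Aut-related to (1, 0, (0; 1), 0); and if Δ(x) ≠ 0 (rank 4), then there exists k > 0 such that x is Aut-related to k·(1, 0, (−1; 1), 0) or k·(1, 0, (1; 1), 0). -/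

import Mathlib

open Real

/-- The Jordan algebra `J = ℝ ⊕ ℝ`, with elements `A = (a; a₀)`. -/
abbrev J2 : Type := ℝ × ℝ

/-- The cubic norm `N(a; a₀) = a a₀²`. -/
noncomputable def Nrm2 (A : J2) : ℝ := A.1 * A.2 ^ 2

/-- The quadratic adjoint `(a; a₀)♯ = (a₀²; a a₀)`. -/
noncomputable def sharp2 (A : J2) : J2 := (A.2 ^ 2, A.1 * A.2)

/-- The trace bilinear form `Tr(A,B) = ab + 2 a₀b₀`. -/
noncomputable def TrF2 (A B : J2) : ℝ := A.1 * B.1 + 2 * A.2 * B.2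

/-- The Freudenthal triple system `F_{2ℝ} = ℝ ⊕ ℝ ⊕ J ⊕ J`, elements `(α, β, A, B)`. -/
abbrev F2R : Type := ℝ × ℝ × J2 × J2

/-- The antisymmetric bilinear form `{x, y} = αδ - βγ + Tr(A,D) - Tr(B,C)`. -/
noncomputable def symp2 (x y : F2R) : ℝ :=
  x.1 * y.2.1 - x.2.1 * y.1 + TrF2 x.2.2.1 y.2.2.2 - TrF2 x.2.2.2 y.2.2.1

/-- The quartic form `Δ(x) = -(αβ - Tr(A,B))² - 4(α N(A) + β N(B) - Tr(A♯, B♯))`. -/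
noncomputable def Dlt2 (x : F2R) : ℝ :=
  -(x.1 * x.2.1 - TrF2 x.2.2.1 x.2.2.2) ^ 2
    - 4 * (x.1 * Nrm2 x.2.2.1 + x.2.1 * Nrm2 x.2.2.2
        - TrF2 (sharp2 x.2.2.1) (sharp2 x.2.2.2))

/-- Membership in `Aut(F_{2ℝ})`: an invertible `ℝ`-linear map preserving `{,}` and `Δ`. -/
def IsAut2 (σ : F2R → F2R) : Prop :=
  Function.Bijective σ ∧ IsLinearMap ℝ σ ∧
    (∀ x y, symp2 (σ x) (σ y) = symp2 x y) ∧ ∀ x, Dlt2 (σ x) = Dlt2 x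

/-- `Aut`-relatedness of two elements of `F_{2ℝ}`. -/
def AutRel2 (x y : F2R) : Prop := ∃ σ, IsAut2 σ ∧ σ x = y

/-- `T` is the triple-product map: `{T(x), z} = ½ (d/ds)|₀ Δ(x + s z)` for all `x, z`. -/
def IsTripleMap2 (T : F2R → F2R) : Prop :=
  ∀ x z, symp2 (T x) z = (1 / 2) * deriv (fun s : ℝ => Dlt2 (x + s • z)) 0

/-- `Υ(x, y) = (d/ds)|₀ T(x + s y) + {x, y} x`. -/
noncomputable def Ups2 (T : F2R → F2R) (x y : F2R) : F2R :=
  deriv (fun s : ℝ => T (x + s • y)) 0 + symp2 x y • x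

/-- The form `{,}` is nondegenerate. -/
lemma eq_of_symp2_eq {x y : F2R} (h : ∀ z, symp2 x z = symp2 y z) : x = y := by
  obtain ⟨α, β, ⟨a, a₀⟩, b, b₀⟩ := x
  obtain ⟨γ, δ, ⟨c, c₀⟩, d, d₀⟩ := y
  have h1 := h (0, 1, (0, 0), (0, 0))
  have h2 := h (1, 0, (0, 0), (0, 0))
  have h3 := h (0, 0, (0, 0), (1, 0))
  have h4 := h (0, 0, (0, 0), (0, 1))
  have h5 := h (0, 0, (1, 0), (0, 0))
  have h6 := h (0, 0, (0, 1), (0, 0))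
  simp [symp2, TrF2] at h1 h2 h3 h4 h5 h6
  simp [h1, h2, h3, h4, h5, h6]

lemma isAut2_of_preserves {σ : F2R → F2R} (hl : IsLinearMap ℝ σ)
    (hs : ∀ x y, symp2 (σ x) (σ y) = symp2 x y) (hd : ∀ x, Dlt2 (σ x) = Dlt2 x) :
    IsAut2 σ := by
  have hinj : Function.Injective (hl.mk' σ) := fun x y hxy =>
    eq_of_symp2_eq fun z => by
      rw [← hs x z, ← hs y z]
      exact congrArg (fun w => symp2 w (σ z)) hxy
  exact ⟨⟨hinj, LinearMap.injective_iff_surjective.mp hinj⟩, hl, hs, hd⟩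

lemma AutRel2.trans {x y z : F2R} (hxy : AutRel2 x y) (hyz : AutRel2 y z) : AutRel2 x z := by
  obtain ⟨σ, ⟨hb, hl, hs, hd⟩, rfl⟩ := hxy
  obtain ⟨τ, ⟨hb', hl', hs', hd'⟩, rfl⟩ := hyz
  exact ⟨τ ∘ σ, ⟨hb'.comp hb, ((hl'.mk' τ).comp (hl.mk' σ)).isLinear,
    fun x y => (hs' _ _).trans (hs x y), fun x => (hd' _).trans (hd x)⟩, rfl⟩

/-! An element `(α, β, (a; a₀), (b; b₀))` is viewed as the pair of binary quadratic forms
`Q₀ = α X² + 2 b₀ XY + a Y²` and `Q₁ = b X² + 2 a₀ XY + β Y²`. -/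

/-- Replace `(Q₀, Q₁)` by `(p Q₀ + q Q₁, r Q₀ + s Q₁)`. -/
noncomputable def mixForms (p q r s : ℝ) (x : F2R) : F2R :=
  (p * x.1 + q * x.2.2.2.1, r * x.2.2.1.1 + s * x.2.1,
    (p * x.2.2.1.1 + q * x.2.1, r * x.2.2.2.2 + s * x.2.2.1.2),
    (r * x.1 + s * x.2.2.2.1, p * x.2.2.2.2 + q * x.2.2.1.2))

/-- Substitute `(t X + u Y, v X + w Y)` for `(X, Y)` in both forms. -/
noncomputable def substForms (t u v w : ℝ) (x : F2R) : F2R :=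
  (x.1 * t ^ 2 + 2 * x.2.2.2.2 * t * v + x.2.2.1.1 * v ^ 2,
    x.2.2.2.1 * u ^ 2 + 2 * x.2.2.1.2 * u * w + x.2.1 * w ^ 2,
    (x.1 * u ^ 2 + 2 * x.2.2.2.2 * u * w + x.2.2.1.1 * w ^ 2,
      x.2.2.2.1 * t * u + x.2.2.1.2 * (t * w + u * v) + x.2.1 * v * w),
    (x.2.2.2.1 * t ^ 2 + 2 * x.2.2.1.2 * t * v + x.2.1 * v ^ 2,
      x.1 * t * u + x.2.2.2.2 * (t * w + u * v) + x.2.2.1.1 * v * w))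

lemma isAut2_mixForms {p q r s : ℝ} (h : p * s - q * r = 1) : IsAut2 (mixForms p q r s) := by
  refine isAut2_of_preserves ⟨fun x y => ?_, fun c x => ?_⟩ (fun x y => ?_) fun x => ?_
  · ext <;> simp [mixForms] <;> ring
  · ext <;> simp [mixForms] <;> ring
  · have h2 : symp2 (mixForms p q r s x) (mixForms p q r s y)
        = (p * s - q * r) * symp2 x y := by
      simp only [symp2, mixForms, TrF2]
      ring
    rw [h2, h, one_mul]
  · have h2 : Dlt2 (mixForms p q r s x) = (p * s - q * r) ^ 2 * Dlt2 x := by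
      simp only [Dlt2, mixForms, TrF2, Nrm2, sharp2]
      ring
    rw [h2, h]; ring

lemma isAut2_substForms {t u v w : ℝ} (h : (t * w - u * v) ^ 2 = 1) :
    IsAut2 (substForms t u v w) := by
  refine isAut2_of_preserves ⟨fun x y => ?_, fun c x => ?_⟩ (fun x y => ?_) fun x => ?_
  · ext <;> simp [substForms] <;> ring
  · ext <;> simp [substForms] <;> ring
  · have h2 : symp2 (substForms t u v w x) (substForms t u v w y)
        = (t * w - u * v) ^ 2 * symp2 x y := by
      simp only [symp2, substForms, TrF2]
      ring
    rw [h2, h, one_mul]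
  · have h2 : Dlt2 (substForms t u v w x) = ((t * w - u * v) ^ 2) ^ 2 * Dlt2 x := by
      simp only [Dlt2, substForms, TrF2, Nrm2, sharp2]
      ring
    rw [h2, h]; ring

lemma autRel2_of_mixForms (p q r s : ℝ) (h : p * s - q * r = 1) {x y : F2R}
    (hxy : mixForms p q r s x = y) : AutRel2 x y := ⟨_, isAut2_mixForms h, hxy⟩

lemma autRel2_of_substForms (t u v w : ℝ) (h : (t * w - u * v) ^ 2 = 1) {x y : F2R}
    (hxy : substForms t u v w x = y) : AutRel2 x y := ⟨_, isAut2_substForms h, hxy⟩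

lemma AutRel2.dlt2_eq {x y : F2R} (h : AutRel2 x y) : Dlt2 y = Dlt2 x := by
  obtain ⟨σ, hσ, rfl⟩ := h
  exact hσ.2.2.2 x

lemma IsAut2.apply_eq_zero_iff {σ : F2R → F2R} (hσ : IsAut2 σ) {x : F2R} :
    σ x = 0 ↔ x = 0 := by
  rw [← hσ.1.1.eq_iff (a := x), hσ.2.1.map_zero]

lemma AutRel2.ne_zero {x y : F2R} (h : AutRel2 x y) (hx : x ≠ 0) : y ≠ 0 := by
  obtain ⟨σ, hσ, rfl⟩ := h
  exact mt hσ.apply_eq_zero_iff.mp hx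

/-- The derivative at `x` in direction `y` of the explicit triple map `tripleMap`. -/
noncomputable def tripleDeriv (x y : F2R) : F2R :=
  let (α, β, (a, a₀), (b, b₀)) := x
  let (γ, δ, (c, c₀), (d, d₀)) := y
  let u := α * β - a * b - 2 * a₀ * b₀
  let u' := γ * β + α * δ - c * b - a * d - 2 * c₀ * b₀ - 2 * a₀ * d₀
  (-u' * α - u * γ - 2 * (d * b₀ ^ 2 + 2 * b * b₀ * d₀),
    u' * β + u * δ + 2 * (c * a₀ ^ 2 + 2 * a * a₀ * c₀),
    (u' * a + u * c - 2 * (δ * b₀ ^ 2 + 2 * β * b₀ * d₀)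
        + 4 * (c * a₀ * b₀ + a * c₀ * b₀ + a * a₀ * d₀),
      u' * a₀ + u * c₀ - 2 * (δ * b * b₀ + β * d * b₀ + β * b * d₀)
        + 2 * (2 * a₀ * c₀ * b₀ + a₀ ^ 2 * d₀) + 2 * (c * a₀ * b + a * c₀ * b + a * a₀ * d)),
    (-(u' * b + u * d) + 2 * (γ * a₀ ^ 2 + 2 * α * a₀ * c₀)
        - 4 * (c₀ * b * b₀ + a₀ * d * b₀ + a₀ * b * d₀),
      -(u' * b₀ + u * d₀) + 2 * (γ * a * a₀ + α * c * a₀ + α * a * c₀)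
        - 2 * (2 * b₀ * d₀ * a₀ + b₀ ^ 2 * c₀) - 2 * (c * b * b₀ + a * d * b₀ + a * b * d₀)))

/-- The explicit triple map. -/
noncomputable def tripleMap (x : F2R) : F2R :=
  let (α, β, (a, a₀), (b, b₀)) := x
  let u := α * β - a * b - 2 * a₀ * b₀
  (-u * α - 2 * b * b₀ ^ 2, u * β + 2 * a * a₀ ^ 2,
    (u * a - 2 * β * b₀ ^ 2 + 4 * a * a₀ * b₀,
      u * a₀ - 2 * β * b * b₀ + 2 * a₀ ^ 2 * b₀ + 2 * a * a₀ * b),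
    (-(u * b) + 2 * α * a₀ ^ 2 - 4 * a₀ * b * b₀,
      -(u * b₀) + 2 * α * a * a₀ - 2 * b₀ ^ 2 * a₀ - 2 * a * b * b₀))

lemma hasDerivAt_of_eq_quartic {E : Type*} [NormedAddCommGroup E] [NormedSpace ℝ E]
    {f : ℝ → E} {A B C D F : E}
    (h : ∀ s, f s = A + s • B + s ^ 2 • C + s ^ 3 • D + s ^ 4 • F) : HasDerivAt f B 0 := by
  rw [funext h]
  have h1 := (hasDerivAt_id (0 : ℝ)).smul_const B
  have h2 := (hasDerivAt_pow 2 (0 : ℝ)).smul_const C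
  have h3 := (hasDerivAt_pow 3 (0 : ℝ)).smul_const D
  have h4 := (hasDerivAt_pow 4 (0 : ℝ)).smul_const F
  convert (((h1.const_add A).add h2).add h3).add h4 using 1
  · rfl
  · simp

lemma dlt2_add_smul (x z : F2R) (s : ℝ) : Dlt2 (x + s • z) =
    Dlt2 x + s • (2 * symp2 (tripleMap x) z) + s ^ 2 • symp2 (tripleDeriv x z) z
      + s ^ 3 • (2 * symp2 (tripleMap z) x) + s ^ 4 • Dlt2 z := by
  obtain ⟨α, β, ⟨a, a₀⟩, b, b₀⟩ := x
  obtain ⟨γ, δ, ⟨c, c₀⟩, d, d₀⟩ := z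
  simp [Dlt2, symp2, TrF2, Nrm2, sharp2, tripleMap, tripleDeriv]
  ring

lemma IsTripleMap2.eq_tripleMap {T : F2R → F2R} (hT : IsTripleMap2 T) : T = tripleMap := by
  funext x
  refine eq_of_symp2_eq fun z => ?_
  rw [hT x z, (hasDerivAt_of_eq_quartic (dlt2_add_smul x z)).deriv]
  ring

lemma tripleMap_add_smul (x y : F2R) (s : ℝ) : tripleMap (x + s • y) =
    tripleMap x + s • tripleDeriv x y + s ^ 2 • tripleDeriv y x + s ^ 3 • tripleMap y := by
  obtain ⟨α, β, ⟨a, a₀⟩, b, b₀⟩ := x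
  obtain ⟨γ, δ, ⟨c, c₀⟩, d, d₀⟩ := y
  ext <;> simp [tripleMap, tripleDeriv] <;> ring

lemma hasDerivAt_tripleMap (x y : F2R) :
    HasDerivAt (fun s : ℝ => tripleMap (x + s • y)) (tripleDeriv x y) 0 :=
  hasDerivAt_of_eq_quartic (A := tripleMap x) (C := tripleDeriv y x) (D := tripleMap y)
    (F := 0) fun s => by rw [tripleMap_add_smul, smul_zero, add_zero]

lemma ups2_tripleMap (x y : F2R) :
    Ups2 tripleMap x y = tripleDeriv x y + symp2 x y • x := by
  rw [Ups2, (hasDerivAt_tripleMap x y).deriv]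

lemma IsAut2.tripleMap_apply {σ : F2R → F2R} (hσ : IsAut2 σ) {T : F2R → F2R}
    (hT : IsTripleMap2 T) (x : F2R) : T (σ x) = σ (T x) := by
  obtain ⟨hb, hl, hs, hd⟩ := hσ
  refine eq_of_symp2_eq fun z => ?_
  obtain ⟨z, rfl⟩ := hb.2 z
  rw [hs, hT, hT]
  simp_rw [← hl.map_smul, ← hl.map_add, hd]

lemma IsAut2.ups2_apply {σ : F2R → F2R} (hσ : IsAut2 σ) {T : F2R → F2R}
    (hT : IsTripleMap2 T) (x y : F2R) : Ups2 T (σ x) (σ y) = σ (Ups2 T x y) := by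
  have hT' := fun x => hσ.tripleMap_apply hT x
  obtain rfl := hT.eq_tripleMap
  obtain ⟨-, hl, hs, -⟩ := hσ
  have hd : HasDerivAt (fun s : ℝ => tripleMap (σ x + s • σ y)) (σ (tripleDeriv x y)) 0 := by
    simp_rw [← hl.map_smul, ← hl.map_add, hT']
    exact (hl.mk' σ).toContinuousLinearMap.hasFDerivAt.comp_hasDerivAt 0
      (hasDerivAt_tripleMap x y)
  rw [Ups2, hd.deriv, ups2_tripleMap, hl.map_add, hl.map_smul, hs]

/-- An indefinite or degenerate binary quadratic form has an isotropic vector, which can be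
completed to a unimodular matrix. -/
lemma exists_isotropic {α b a : ℝ} (h : 0 ≤ b ^ 2 - α * a) :
    ∃ t u v w : ℝ, t * w - u * v = 1 ∧ α * t ^ 2 + 2 * b * t * v + a * v ^ 2 = 0 := by
  by_cases hα : α = 0
  · exact ⟨1, 0, 0, 1, by norm_num, by simp [hα]⟩
  · have hr := Real.sq_sqrt h
    set r := √(b ^ 2 - α * a)
    have hn : (-b + r) ^ 2 + α ^ 2 ≠ 0 := by positivity
    refine ⟨-b + r, -α / ((-b + r) ^ 2 + α ^ 2), α, (-b + r) / ((-b + r) ^ 2 + α ^ 2), ?_, ?_⟩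
    · field_simp
      ring
    · linear_combination α * hr

/-- If `Δ(x) ≤ 0`, some member of the pencil spanned by `Q₀` and `Q₁` is degenerate. -/
lemma exists_autRel2_disc_eq_zero {x : F2R} (hx : Dlt2 x ≤ 0) :
    ∃ y : F2R, AutRel2 x y ∧ y.2.2.1.2 ^ 2 - y.2.2.2.1 * y.2.1 = 0 := by
  obtain ⟨α, β, ⟨a, a₀⟩, b, b₀⟩ := x
  simp only [Dlt2, TrF2, Nrm2, sharp2] at hx
  obtain ⟨r, u, s, w, h1, h2⟩ := exists_isotropic (α := α * a - b₀ ^ 2)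
    (b := (α * β + a * b - 2 * a₀ * b₀) / 2) (a := b * β - a₀ ^ 2) (by nlinarith)
  refine ⟨_, autRel2_of_mixForms (-u) (-w) r s (by linarith) rfl, ?_⟩
  simp only [mixForms]
  linear_combination -h2

/-- A degenerate `Q₁` can be made a multiple of `X²`. -/
lemma exists_autRel2_of_disc_eq_zero {x : F2R} (hx : x.2.2.1.2 ^ 2 - x.2.2.2.1 * x.2.1 = 0) :
    ∃ y : F2R, AutRel2 x y ∧ y.2.1 = 0 ∧ y.2.2.1.2 = 0 := by
  obtain ⟨α, β, ⟨a, a₀⟩, b, b₀⟩ := x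
  obtain ⟨u, t, w, v, h1, h2⟩ := exists_isotropic hx.ge
  refine ⟨_, autRel2_of_substForms t u v w (by nlinarith) rfl, h2, ?_⟩
  simp only [substForms] at hx ⊢
  rw [← sq_eq_zero_iff]
  linear_combination (b * t ^ 2 + 2 * a₀ * t * v + β * v ^ 2) * h2 +
    (u * v - t * w) ^ 2 * hx

/-- If `Δ(x) ≤ 0` then `x` is related to a pair of forms with `Q₁` a multiple of `X²`. -/
lemma exists_autRel2_degenerate {x : F2R} (hx : Dlt2 x ≤ 0) :
    ∃ α a b b₀ : ℝ, AutRel2 x (α, 0, (a, 0), (b, b₀)) := by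
  obtain ⟨y, hy, hy'⟩ := exists_autRel2_disc_eq_zero hx
  obtain ⟨⟨α, β, ⟨a, a₀⟩, b, b₀⟩, hz, rfl, rfl⟩ := exists_autRel2_of_disc_eq_zero hy'
  exact ⟨α, a, b, b₀, hy.trans hz⟩

/-- `x` is related to one of the canonical forms. -/
def HasCanonicalForm (x : F2R) : Prop :=
  AutRel2 x (1, 0, 0, 0) ∨ AutRel2 x (1, 0, (1, 0), 0) ∨ AutRel2 x (1, 0, (-1, 0), 0) ∨
    AutRel2 x (1, 0, (0, 1), 0) ∨
    ∃ k : ℝ, 0 < k ∧ (AutRel2 x (k • ((1 : ℝ), (0 : ℝ), ((-1 : ℝ), (1 : ℝ)), (0 : J2))) ∨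
      AutRel2 x (k • ((1 : ℝ), (0 : ℝ), ((1 : ℝ), (1 : ℝ)), (0 : J2))))

lemma AutRel2.hasCanonicalForm {x y : F2R} (h : AutRel2 x y) (hy : HasCanonicalForm y) :
    HasCanonicalForm x := by
  obtain hy | hy | hy | hy | ⟨k, hk, hy | hy⟩ := hy
  · exact .inl (h.trans hy)
  · exact .inr (.inl (h.trans hy))
  · exact .inr (.inr (.inl (h.trans hy)))
  · exact .inr (.inr (.inr (.inl (h.trans hy))))
  · exact .inr (.inr (.inr (.inr ⟨k, hk, .inl (h.trans hy)⟩)))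
  · exact .inr (.inr (.inr (.inr ⟨k, hk, .inr (h.trans hy)⟩)))

/-- The pair `(a Y², b X²)` with `a` and `b` of the same sign. -/
lemma hasCanonicalForm_split_of_mul_pos {a b : ℝ} (hab : 0 < a * b) :
    HasCanonicalForm (0, 0, (a, 0), (b, 0)) := by
  have hk : 0 < √(a * b / 2) := by positivity
  have hk2 : √(a * b / 2) ^ 2 = a * b / 2 := Real.sq_sqrt (by positivity)
  set k := √(a * b / 2)
  have ha : a ≠ 0 := left_ne_zero_of_mul hab.ne'
  have hb : b ≠ 0 := right_ne_zero_of_mul hab.ne'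
  refine .inr (.inr (.inr (.inr ⟨k, hk, .inr ?_⟩)))
  refine (autRel2_of_substForms 1 1 (1 / 2) (-1 / 2) (by norm_num) rfl).trans
    (autRel2_of_mixForms (2 * k / a) (k / (2 * b)) (-2 * k / a) (k / (2 * b)) ?_ ?_)
  · field_simp
    linear_combination 2 * hk2
  · ext <;> simp [mixForms, substForms] <;> field_simp <;> ring

/-- The pair `(a Y², b X²)`. -/
lemma hasCanonicalForm_split {a b : ℝ} (ha : a ≠ 0) (hb : b ≠ 0) :
    HasCanonicalForm (0, 0, (a, 0), (b, 0)) := by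
  obtain h | h := (mul_ne_zero ha hb).lt_or_gt
  · refine AutRel2.hasCanonicalForm ((autRel2_of_mixForms 0 1 (-1) 0 (by norm_num) rfl).trans
      (autRel2_of_substForms 0 1 1 0 (by norm_num) ?_))
      (hasCanonicalForm_split_of_mul_pos (a := b) (b := -a) (by linarith))
    ext <;> simp [mixForms, substForms]
  · exact hasCanonicalForm_split_of_mul_pos h

/-- The pair `(2 b₀ XY, b X²)`. -/
lemma hasCanonicalForm_tangent {b b₀ : ℝ} (hb : b ≠ 0) (hb₀ : b₀ ≠ 0) :
    HasCanonicalForm (0, 0, (0, 0), (b, b₀)) := by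
  obtain ⟨e, he, t, ht, h⟩ : ∃ e : ℝ, e ^ 2 = 1 ∧ ∃ t : ℝ, t ≠ 0 ∧ -b₀ * e * b * t ^ 2 = 1 := by
    have key : ∀ c : ℝ, 0 < c → ∃ t : ℝ, t ≠ 0 ∧ c * t ^ 2 = 1 := fun c hc =>
      ⟨(√c)⁻¹, by positivity, by rw [inv_pow, Real.sq_sqrt hc.le]; exact mul_inv_cancel₀ hc.ne'⟩
    obtain h | h := (mul_ne_zero hb hb₀).lt_or_gt
    · obtain ⟨t, ht, h⟩ := key (-(b * b₀)) (by linarith)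
      exact ⟨1, by norm_num, t, ht, by linarith⟩
    · obtain ⟨t, ht, h⟩ := key (b * b₀) h
      exact ⟨-1, by norm_num, t, ht, by linarith⟩
  refine .inr (.inr (.inr (.inl ((autRel2_of_substForms t 0 0 (e / t) ?_ rfl).trans
    (autRel2_of_mixForms 0 (-b₀ * e) (e / b₀) 0 ?_ ?_)))))
  · field_simp
    linear_combination he
  · field_simp
    linear_combination he
  · ext <;> simp [mixForms, substForms]
    · linear_combination h
    · field_simp
      linear_combination he

/-- The pair `(α X² + a Y², 0)`. -/
lemma hasCanonicalForm_diagonal {α a : ℝ} (ha : a ≠ 0) :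
    HasCanonicalForm (α, 0, (a, 0), (0, 0)) := by
  by_cases hα : α = 0
  · subst hα
    refine .inl ((autRel2_of_substForms 0 1 1 0 (by norm_num) rfl).trans
      (autRel2_of_mixForms a⁻¹ 0 0 a (by field_simp; ring) ?_))
    ext <;> simp [mixForms, substForms, ha]
  · have hpos : 0 < |a / α| := by positivity
    have ht : √(√|a / α|) ^ 4 = |a / α| := by
      rw [show (4 : ℕ) = 2 * 2 by norm_num, pow_mul, Real.sq_sqrt (by positivity),
        Real.sq_sqrt hpos.le]
    have ht0 : √(√|a / α|) ≠ 0 := by positivity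
    set t := √(√|a / α|)
    have key : AutRel2 (α, 0, (a, 0), (0, 0)) (1, 0, (a / (α * t ^ 4), 0), 0) := by
      refine (autRel2_of_substForms t 0 0 t⁻¹ (by field_simp; norm_num) rfl).trans
        (autRel2_of_mixForms (1 / (α * t ^ 2)) 0 0 (α * t ^ 2) (by field_simp; ring) ?_)
      ext <;> simp [mixForms, substForms] <;> field_simp
    have e : a / (α * t ^ 4) = (a / α) / |a / α| := by rw [ht, div_div]
    rw [e] at key
    obtain h | h := abs_choice (a / α)
    · rw [h, div_self (by positivity)] at key
      exact .inr (.inl key)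
    · rw [h, div_neg, div_self (by positivity)] at key
      exact .inr (.inr (.inl key))

/-- The pair `(Q₀, 0)`. -/
lemma hasCanonicalForm_single {α a b₀ : ℝ} (h : (α, a, b₀) ≠ 0) :
    HasCanonicalForm (α, 0, (a, 0), (0, b₀)) := by
  have main : ∀ α a b₀ : ℝ, a ≠ 0 → HasCanonicalForm (α, 0, (a, 0), (0, b₀)) := by
    intro α a b₀ ha
    refine AutRel2.hasCanonicalForm (autRel2_of_substForms 1 0 (-b₀ / a) 1 (by norm_num) ?_)
      (hasCanonicalForm_diagonal (α := α - b₀ ^ 2 / a) ha)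
    ext <;> simp [substForms] <;> field_simp <;> ring
  by_cases ha : a = 0
  · subst ha
    by_cases hα : α = 0
    · subst hα
      refine AutRel2.hasCanonicalForm (autRel2_of_substForms 1 1 0 1 (by norm_num) ?_)
        (main 0 (2 * b₀) b₀ (by simpa using h))
      ext <;> simp [substForms]
    · refine AutRel2.hasCanonicalForm (autRel2_of_substForms 0 1 1 0 (by norm_num) ?_)
        (main 0 α b₀ hα)
      ext <;> simp [substForms]
  · exact main α a b₀ ha

lemma hasCanonicalForm_degenerate {α a b b₀ : ℝ} (h : (α, a, b, b₀) ≠ 0) :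
    HasCanonicalForm (α, 0, (a, 0), (b, b₀)) := by
  by_cases hb : b = 0
  · subst hb
    exact hasCanonicalForm_single (by simpa using h)
  by_cases ha : a = 0
  · subst ha
    refine AutRel2.hasCanonicalForm (y := (0, 0, (0, 0), (b, b₀)))
      (autRel2_of_mixForms 1 (-α / b) 0 1 (by norm_num) ?_) ?_
    · ext <;> simp [mixForms]
      field_simp
      ring
    by_cases hb₀ : b₀ = 0
    · subst hb₀
      refine .inl (autRel2_of_mixForms 0 b⁻¹ (-b) 0 (by field_simp; norm_num) ?_)
      ext <;> simp [mixForms, hb]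
    · exact hasCanonicalForm_tangent hb hb₀
  · refine AutRel2.hasCanonicalForm
      ((autRel2_of_substForms 1 0 (-b₀ / a) 1 (by norm_num) rfl).trans
        (autRel2_of_mixForms 1 (-(α - b₀ ^ 2 / a) / b) 0 1 (by norm_num) ?_))
      (hasCanonicalForm_split ha hb)
    ext <;> simp [mixForms, substForms] <;> field_simp <;> ring

/-- The pair `(2 b₀ XY, b X² + β Y²)` with `β` and `b` of opposite signs. -/
lemma hasCanonicalForm_nonsplit {β b b₀ : ℝ} (h : β * b < 0) (hb₀ : b₀ ≠ 0) :
    HasCanonicalForm (0, β, (0, 0), (b, b₀)) := by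
  have hβ : β ≠ 0 := left_ne_zero_of_mul h.ne
  have hb : b ≠ 0 := right_ne_zero_of_mul h.ne
  have hdiv : 0 < -β / b := by
    rw [neg_div, neg_pos]
    exact div_neg_iff.mpr (by rcases mul_neg_iff.mp h with h | h <;> simp [h])
  have ht : √(√(-β / b)) ^ 4 = -β / b := by
    rw [show (4 : ℕ) = 2 * 2 by norm_num, pow_mul, Real.sq_sqrt (by positivity),
      Real.sq_sqrt hdiv.le]
  have ht0 : √(√(-β / b)) ≠ 0 := by positivity
  set t := √(√(-β / b))
  obtain ⟨e, he, hneg⟩ : ∃ e : ℝ, e ^ 2 = 1 ∧ 0 < -(b * b₀ * e) := by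
    obtain h | h := (mul_ne_zero hb hb₀).lt_or_gt
    · exact ⟨1, by norm_num, by linarith⟩
    · exact ⟨-1, by norm_num, by linarith⟩
  have hpos : 0 < -(b * b₀ * e) * t ^ 2 := by positivity
  have hk : 0 < √(-(b * b₀ * e) * t ^ 2) := by positivity
  have hk2 := Real.sq_sqrt hpos.le
  set k := √(-(b * b₀ * e) * t ^ 2)
  have he0 : e ≠ 0 := by rintro rfl; norm_num at he
  have hβ' : β = -b * t ^ 4 := by rw [ht]; field_simp
  refine .inr (.inr (.inr (.inr ⟨k, hk, .inl
    ((autRel2_of_substForms t 0 0 (e / t) (by field_simp; linear_combination he) rfl).trans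
      (autRel2_of_mixForms 0 (k / (b * t ^ 2)) (k / (b₀ * e)) 0 ?_ ?_))⟩)))
  · field_simp
    linear_combination -hk2
  · ext <;> simp [mixForms, substForms]
    · field_simp
    · rw [hβ']
      field_simp
      linear_combination -he
    · field_simp

lemma hasCanonicalForm_of_dlt2_pos {x : F2R} (hx : 0 < Dlt2 x) : HasCanonicalForm x := by
  obtain ⟨y, hxy, hy⟩ : ∃ y : F2R, AutRel2 x y ∧ y.1 = 0 := by
    obtain ⟨α, β, ⟨a, a₀⟩, b, b₀⟩ := x
    simp only [Dlt2, TrF2, Nrm2, sharp2] at hx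
    obtain ⟨t, u, v, w, h1, h2⟩ := exists_isotropic (α := α) (b := b₀) (a := a) (by
      by_contra! h
      have hα : 0 < α ^ 2 := by
        rw [sq_pos_iff]
        rintro rfl
        nlinarith [sq_nonneg b₀]
      nlinarith [mul_pos hα hx, mul_nonneg (neg_pos.mpr h).le (sq_nonneg (α * a₀ - b₀ * b)),
        sq_nonneg (α ^ 2 * β - 2 * α * b₀ * a₀ + b₀ ^ 2 * b - b * (α * a - b₀ ^ 2))])
    exact ⟨_, autRel2_of_substForms t u v w (by rw [h1, one_pow]) rfl, h2⟩
  rw [← hxy.dlt2_eq] at hx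
  refine hxy.hasCanonicalForm ?_
  clear hxy
  obtain ⟨α, β, ⟨a, a₀⟩, b, b₀⟩ := y
  obtain rfl : α = 0 := hy
  have hb₀ : b₀ ≠ 0 := by
    rintro rfl
    simp only [Dlt2, TrF2, Nrm2, sharp2] at hx
    nlinarith [sq_nonneg (a * b)]
  have hrel : AutRel2 (0, β, (a, a₀), (b, b₀)) (0, _, (0, 0), (b, b₀)) :=
    (autRel2_of_substForms 1 (-a / (2 * b₀)) 0 1 (by norm_num) rfl).trans
      (autRel2_of_mixForms 1 0 (-(a₀ - b * a / (2 * b₀)) / b₀) 1 (by norm_num) (by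
        ext
        case snd.fst => rfl
        all_goals simp [substForms, mixForms]
        all_goals field_simp
        all_goals ring))
  refine hrel.hasCanonicalForm (hasCanonicalForm_nonsplit ?_ hb₀)
  rw [← hrel.dlt2_eq] at hx
  simp only [Dlt2, TrF2, Nrm2, sharp2] at hx
  have := sq_pos_of_ne_zero hb₀
  by_contra! h
  nlinarith [mul_nonneg h this.le]

theorem hasCanonicalForm {x : F2R} (hx : x ≠ 0) : HasCanonicalForm x := by
  obtain h | h := le_or_gt (Dlt2 x) 0
  · obtain ⟨α, a, b, b₀, hrel⟩ := exists_autRel2_degenerate h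
    refine hrel.hasCanonicalForm (hasCanonicalForm_degenerate fun h0 => hrel.ne_zero hx ?_)
    simp_all
  · exact hasCanonicalForm_of_dlt2_pos h

lemma AutRel2.tripleMap_eq_zero_iff {x y : F2R} (h : AutRel2 x y) (hT : IsTripleMap2 tripleMap) :
    tripleMap y = 0 ↔ tripleMap x = 0 := by
  obtain ⟨σ, hσ, rfl⟩ := h
  rw [hσ.tripleMap_apply hT, hσ.apply_eq_zero_iff]

lemma AutRel2.forall_ups2_eq_zero_iff {x y : F2R} (h : AutRel2 x y)
    (hT : IsTripleMap2 tripleMap) :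
    (∀ z, Ups2 tripleMap y z = 0) ↔ ∀ z, Ups2 tripleMap x z = 0 := by
  obtain ⟨σ, hσ, rfl⟩ := h
  rw [hσ.1.2.forall]
  refine forall_congr' fun z => ?_
  rw [hσ.ups2_apply hT, hσ.apply_eq_zero_iff]

lemma dlt2_eq_zero_of_tripleMap_eq_zero {x : F2R} (h : tripleMap x = 0) : Dlt2 x = 0 := by
  have h1 : symp2 (tripleMap x) x = 2 * Dlt2 x := by
    simp only [tripleMap, symp2, Dlt2, TrF2, Nrm2, sharp2]
    ring
  simpa [h, symp2, TrF2] using h1.symm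

lemma AutRel2.rank_two {x : F2R} {c : ℝ} (h : AutRel2 x (1, 0, (c, 0), 0))
    (hT : IsTripleMap2 tripleMap) (hc : c ≠ 0) :
    (¬ ∀ y, Ups2 tripleMap x y = 0) ∧ tripleMap x = 0 ∧ Dlt2 x = 0 := by
  have hT0 := (h.tripleMap_eq_zero_iff hT).mp (by ext <;> simp [tripleMap])
  refine ⟨?_, hT0, dlt2_eq_zero_of_tripleMap_eq_zero hT0⟩
  rw [← h.forall_ups2_eq_zero_iff hT]
  intro h0
  have := congrArg Prod.fst (h0 (0, 0, 0, (1, 0)))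
  simp [ups2_tripleMap, tripleDeriv, symp2, TrF2] at this
  exact hc (by linarith)

lemma AutRel2.rank_four {x : F2R} {k c : ℝ}
    (h : AutRel2 x (k • ((1 : ℝ), (0 : ℝ), (c, (1 : ℝ)), (0 : J2))))
    (hT : IsTripleMap2 tripleMap) (hk : k ≠ 0) (hc : c ≠ 0) :
    (¬ ∀ y, Ups2 tripleMap x y = 0) ∧ Dlt2 x ≠ 0 := by
  constructor
  · rw [← h.forall_ups2_eq_zero_iff hT]
    intro h0
    have := congrArg Prod.fst (h0 (0, 0, 0, (0, 1)))
    simp [ups2_tripleMap, tripleDeriv, symp2, TrF2] at this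
    exact hk (by nlinarith)
  · rw [← h.dlt2_eq]
    simp [Dlt2, TrF2, Nrm2, sharp2, hk, hc]

/-- classification of the `Aut(F_{2ℝ})`-orbits by rank: rank-1 elements are
`Aut`-related to `(1,0,0,0)`; rank-2 elements to `(1,0,(1;0),0)` or `(1,0,(-1;0),0)`;
rank-3 elements to `(1,0,(0;1),0)`; rank-4 elements to `k(1,0,(-1;1),0)` or
`k(1,0,(1;1),0)` for some `k > 0`. -/
theorem f2r_orbit_classification (T : F2R → F2R) (hT : IsTripleMap2 T) (x : F2R) :
    ((x ≠ 0 ∧ ∀ y, Ups2 T x y = 0) → AutRel2 x (1, 0, 0, 0)) ∧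
    ((T x = 0 ∧ ∃ y, Ups2 T x y ≠ 0) →
      AutRel2 x (1, 0, ((1 : ℝ), (0 : ℝ)), 0) ∨
      AutRel2 x (1, 0, ((-1 : ℝ), (0 : ℝ)), 0)) ∧
    ((Dlt2 x = 0 ∧ T x ≠ 0) → AutRel2 x (1, 0, ((0 : ℝ), (1 : ℝ)), 0)) ∧
    (Dlt2 x ≠ 0 → ∃ k : ℝ, 0 < k ∧
      (AutRel2 x (k • ((1 : ℝ), (0 : ℝ), ((-1 : ℝ), (1 : ℝ)), (0 : J2))) ∨
       AutRel2 x (k • ((1 : ℝ), (0 : ℝ), ((1 : ℝ), (1 : ℝ)), (0 : J2))))) := by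
  obtain rfl := hT.eq_tripleMap
  rw [← not_forall_not (p := fun y => Ups2 tripleMap x y ≠ 0)]
  simp only [not_not]
  by_cases hx : x = 0
  · subst hx
    have hU : ∀ y, Ups2 tripleMap 0 y = 0 := fun y => by
      rw [ups2_tripleMap]
      ext <;> simp [tripleDeriv]
    have hT0 : tripleMap 0 = 0 := by ext <;> simp [tripleMap]
    have hD : Dlt2 0 = 0 := by simp [Dlt2, TrF2, Nrm2, sharp2]
    tauto
  rcases hasCanonicalForm hx with h | h | h | h | ⟨k, hk, h⟩
  · have hU := (h.forall_ups2_eq_zero_iff hT).mp fun y => by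
      rw [ups2_tripleMap]
      ext <;> simp [tripleDeriv, symp2, TrF2]
    have hT0 := (h.tripleMap_eq_zero_iff hT).mp (by ext <;> simp [tripleMap])
    have hD := h.dlt2_eq.symm.trans (by simp [Dlt2, TrF2, Nrm2, sharp2] : _ = (0 : ℝ))
    tauto
  · obtain ⟨hU, hT0, hD⟩ := h.rank_two hT one_ne_zero
    tauto
  · obtain ⟨hU, hT0, hD⟩ := h.rank_two hT (neg_ne_zero.mpr one_ne_zero)
    tauto
  · have hU : ¬ ∀ y, Ups2 tripleMap x y = 0 := by
      rw [← h.forall_ups2_eq_zero_iff hT]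
      intro h0
      have := congrArg Prod.fst (h0 (0, 0, 0, (0, 1)))
      norm_num [ups2_tripleMap, tripleDeriv, symp2, TrF2] at this
    have hT0 : tripleMap x ≠ 0 := by
      rw [Ne, ← h.tripleMap_eq_zero_iff hT]
      simp [tripleMap, Prod.ext_iff]
    have hD := h.dlt2_eq.symm.trans (by simp [Dlt2, TrF2, Nrm2, sharp2] : _ = (0 : ℝ))
    tauto
  · obtain ⟨hU, hD⟩ : (¬ ∀ y, Ups2 tripleMap x y = 0) ∧ Dlt2 x ≠ 0 := by
      rcases h with h | h
      · exact h.rank_four hT hk.ne' (neg_ne_zero.mpr one_ne_zero)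
      · exact h.rank_four hT hk.ne' one_ne_zero
    have hT0 : tripleMap x ≠ 0 := fun h0 => hD (dlt2_eq_zero_of_tripleMap_eq_zero h0)
    exact ⟨fun h => absurd h.2 hU, fun h => absurd h.1 hT0, fun h => absurd h.1 hD,
      fun _ => ⟨k, hk, h⟩⟩
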